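/- arXiv:1407.5651 — 3 statements merged into one kernel-verified Lean document; each statement's English description precedes it below -/
import Mathlib

section
/- For every choice of positive rate constants k1,…,k36 and every x ∈ ℝ^25, the mass action vector field of Net3 vanishes at x (f(x) = 0) if and only if the following 18 binomials all vanish at x: (k2+k3)x13 − k1·x1·x9, (k5+k6)x18 − k4·x2·x10, k3·x13 − k6·x18, (k8+k9)x14 − k7·x2·x3, (k17+k18)x20 − k16·x4·x11, k9·x14 − k18·x20, (k11+k12)x15 − k10·x2·x4, (k14+k15)x19 − k13·x5·x11, k12·x15 − k15·x19, (k20+k21)x16 − k19·x5·x6, (k29+k30)x22 − k28·x7·x11, k21·x16 − k30·x22, (k23+k24)x17 − k22·x5·x7, (k26+k27)x21 − k25·x8·x11, k24·x17 − k27·x21, (k32+k33)x23 − k31·x2·x8, (k35+k36)x24 − k34·x12·x25, k33·x23 − k36·x24. -/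
/-- The `j`-th standard basis vector of `ℕ^25`. -/
def ee (j : Fin 25) : Fin 25 → ℕ := fun i => if i = j then 1 else 0

/-- The 12 motifs `A + B ⇄ C → D + B` of Net3, recorded as tuples `(A, B, C, D)`
(0-based species indices, so `Xⱼ` is index `j - 1`). -/
def motifs3 : Fin 12 → Fin 25 × Fin 25 × Fin 25 × Fin 25 :=
  ![(0, 8, 12, 1),
    (1, 9, 17, 0),
    (2, 1, 13, 3),
    (3, 1, 14, 4),
    (4, 10, 18, 3),
    (3, 10, 19, 2),
    (5, 4, 15, 6),
    (6, 4, 16, 7),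
    (7, 10, 20, 6),
    (6, 10, 21, 5),
    (1, 7, 22, 24),
    (24, 11, 23, 1)]

/-- Exponent vector of the source complex of the `i`-th reaction of Net3
(motif `i / 3`; reactions `A+B → C`, `C → A+B`, `C → D+B`). -/
def src3 (i : Fin 36) : Fin 25 → ℕ :=
  let m := motifs3 ⟨i.val / 3, by have := i.isLt; omega⟩
  if i.val % 3 = 0 then ee m.1 + ee m.2.1 else ee m.2.2.1

/-- Exponent vector of the product complex of the `i`-th reaction of Net3. -/
def tgt3 (i : Fin 36) : Fin 25 → ℕ :=
  let m := motifs3 ⟨i.val / 3, by have := i.isLt; omega⟩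
  if i.val % 3 = 0 then ee m.2.2.1
  else if i.val % 3 = 1 then ee m.1 + ee m.2.1
  else ee m.2.2.2 + ee m.2.1

/-- The mass action vector field of Net3: `f(x)ⱼ = Σᵢ kᵢ x^{yᵢ} ((yᵢ')ⱼ − (yᵢ)ⱼ)`. -/
def massAction3 (k : Fin 36 → ℝ) (x : Fin 25 → ℝ) : Fin 25 → ℝ :=
  fun j => ∑ i : Fin 36,
    k i * (∏ l : Fin 25, x l ^ src3 i l) * ((tgt3 i j : ℝ) - (src3 i j : ℝ))

theorem prod_ee (x : Fin 25 → ℝ) (a : Fin 25) : ∏ l : Fin 25, x l ^ ee a l = x a := by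
  simp [ee, pow_ite]

theorem prod_ee2 (x : Fin 25 → ℝ) (a b : Fin 25) :
    ∏ l : Fin 25, x l ^ (ee a + ee b) l = x a * x b := by
  simp only [Pi.add_apply, pow_add, Finset.prod_mul_distrib, prod_ee]

/-- contribution of one motif -/
def mot (u v w : ℝ) (x : Fin 25 → ℝ) (a b c d j : Fin 25) : ℝ :=
  u * (x a * x b) * ((ee c j : ℝ) - ((ee a + ee b) j : ℕ)) +
  v * x c * (((ee a + ee b) j : ℕ) - (ee c j : ℝ)) +
  w * x c * (((ee d + ee b) j : ℕ) - (ee c j : ℝ))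

theorem sum36 (g : Fin 36 → ℝ) : ∑ i, g i =
    (g 0 + g 1 + g 2) +
    (g 3 + g 4 + g 5) +
    (g 6 + g 7 + g 8) +
    (g 9 + g 10 + g 11) +
    (g 12 + g 13 + g 14) +
    (g 15 + g 16 + g 17) +
    (g 18 + g 19 + g 20) +
    (g 21 + g 22 + g 23) +
    (g 24 + g 25 + g 26) +
    (g 27 + g 28 + g 29) +
    (g 30 + g 31 + g 32) +
    (g 33 + g 34 + g 35) := by
  simp only [Fin.sum_univ_castSucc, Fin.sum_univ_zero]
  simp only [← add_assoc, zero_add]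
  rfl

theorem massAction_eq (k : Fin 36 → ℝ) (x : Fin 25 → ℝ) (j : Fin 25) : massAction3 k x j =
    mot (k 0) (k 1) (k 2) x 0 8 12 1 j +
    mot (k 3) (k 4) (k 5) x 1 9 17 0 j +
    mot (k 6) (k 7) (k 8) x 2 1 13 3 j +
    mot (k 9) (k 10) (k 11) x 3 1 14 4 j +
    mot (k 12) (k 13) (k 14) x 4 10 18 3 j +
    mot (k 15) (k 16) (k 17) x 3 10 19 2 j +
    mot (k 18) (k 19) (k 20) x 5 4 15 6 j +
    mot (k 21) (k 22) (k 23) x 6 4 16 7 j +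
    mot (k 24) (k 25) (k 26) x 7 10 20 6 j +
    mot (k 27) (k 28) (k 29) x 6 10 21 5 j +
    mot (k 30) (k 31) (k 32) x 1 7 22 24 j +
    mot (k 33) (k 34) (k 35) x 24 11 23 1 j := by
  unfold massAction3
  rw [sum36]
  rw [show src3 0 = ee 0 + ee 8 from rfl, show src3 1 = ee 12 from rfl,
    show src3 2 = ee 12 from rfl, show tgt3 0 = ee 12 from rfl,
    show tgt3 1 = ee 0 + ee 8 from rfl, show tgt3 2 = ee 1 + ee 8 from rfl]
  rw [show src3 3 = ee 1 + ee 9 from rfl, show src3 4 = ee 17 from rfl,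
    show src3 5 = ee 17 from rfl, show tgt3 3 = ee 17 from rfl,
    show tgt3 4 = ee 1 + ee 9 from rfl, show tgt3 5 = ee 0 + ee 9 from rfl]
  rw [show src3 6 = ee 2 + ee 1 from rfl, show src3 7 = ee 13 from rfl,
    show src3 8 = ee 13 from rfl, show tgt3 6 = ee 13 from rfl,
    show tgt3 7 = ee 2 + ee 1 from rfl, show tgt3 8 = ee 3 + ee 1 from rfl]
  rw [show src3 9 = ee 3 + ee 1 from rfl, show src3 10 = ee 14 from rfl,
    show src3 11 = ee 14 from rfl, show tgt3 9 = ee 14 from rfl,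
    show tgt3 10 = ee 3 + ee 1 from rfl, show tgt3 11 = ee 4 + ee 1 from rfl]
  rw [show src3 12 = ee 4 + ee 10 from rfl, show src3 13 = ee 18 from rfl,
    show src3 14 = ee 18 from rfl, show tgt3 12 = ee 18 from rfl,
    show tgt3 13 = ee 4 + ee 10 from rfl, show tgt3 14 = ee 3 + ee 10 from rfl]
  rw [show src3 15 = ee 3 + ee 10 from rfl, show src3 16 = ee 19 from rfl,
    show src3 17 = ee 19 from rfl, show tgt3 15 = ee 19 from rfl,
    show tgt3 16 = ee 3 + ee 10 from rfl, show tgt3 17 = ee 2 + ee 10 from rfl]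
  rw [show src3 18 = ee 5 + ee 4 from rfl, show src3 19 = ee 15 from rfl,
    show src3 20 = ee 15 from rfl, show tgt3 18 = ee 15 from rfl,
    show tgt3 19 = ee 5 + ee 4 from rfl, show tgt3 20 = ee 6 + ee 4 from rfl]
  rw [show src3 21 = ee 6 + ee 4 from rfl, show src3 22 = ee 16 from rfl,
    show src3 23 = ee 16 from rfl, show tgt3 21 = ee 16 from rfl,
    show tgt3 22 = ee 6 + ee 4 from rfl, show tgt3 23 = ee 7 + ee 4 from rfl]
  rw [show src3 24 = ee 7 + ee 10 from rfl, show src3 25 = ee 20 from rfl,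
    show src3 26 = ee 20 from rfl, show tgt3 24 = ee 20 from rfl,
    show tgt3 25 = ee 7 + ee 10 from rfl, show tgt3 26 = ee 6 + ee 10 from rfl]
  rw [show src3 27 = ee 6 + ee 10 from rfl, show src3 28 = ee 21 from rfl,
    show src3 29 = ee 21 from rfl, show tgt3 27 = ee 21 from rfl,
    show tgt3 28 = ee 6 + ee 10 from rfl, show tgt3 29 = ee 5 + ee 10 from rfl]
  rw [show src3 30 = ee 1 + ee 7 from rfl, show src3 31 = ee 22 from rfl,
    show src3 32 = ee 22 from rfl, show tgt3 30 = ee 22 from rfl,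
    show tgt3 31 = ee 1 + ee 7 from rfl, show tgt3 32 = ee 24 + ee 7 from rfl]
  rw [show src3 33 = ee 24 + ee 11 from rfl, show src3 34 = ee 23 from rfl,
    show src3 35 = ee 23 from rfl, show tgt3 33 = ee 23 from rfl,
    show tgt3 34 = ee 24 + ee 11 from rfl, show tgt3 35 = ee 1 + ee 11 from rfl]
  simp only [prod_ee, prod_ee2]
  rfl

set_option maxHeartbeats 4000000 in
/-- For every choice of positive rate constants and every `x ∈ ℝ^25`, the mass action
vector field of Net3 vanishes at `x` iff the 18 binomials vanish at `x`.
(Rate constant `kⱼ` of the paper is `k (j-1)` here, species `Xⱼ` is `x (j-1)`.) -/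
theorem net3_steady_state_iff_binomials (k : Fin 36 → ℝ) (hk : ∀ i, 0 < k i)
    (x : Fin 25 → ℝ) :
    massAction3 k x = 0 ↔
      (((k 1 + k 2) * x 12 - k 0 * (x 0 * x 8) = 0) ∧
      ((k 4 + k 5) * x 17 - k 3 * (x 1 * x 9) = 0) ∧
      (k 2 * x 12 - k 5 * x 17 = 0) ∧
      ((k 7 + k 8) * x 13 - k 6 * (x 1 * x 2) = 0) ∧
      ((k 16 + k 17) * x 19 - k 15 * (x 3 * x 10) = 0) ∧
      (k 8 * x 13 - k 17 * x 19 = 0) ∧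
      ((k 10 + k 11) * x 14 - k 9 * (x 1 * x 3) = 0) ∧
      ((k 13 + k 14) * x 18 - k 12 * (x 4 * x 10) = 0) ∧
      (k 11 * x 14 - k 14 * x 18 = 0) ∧
      ((k 19 + k 20) * x 15 - k 18 * (x 4 * x 5) = 0) ∧
      ((k 28 + k 29) * x 21 - k 27 * (x 6 * x 10) = 0) ∧
      (k 20 * x 15 - k 29 * x 21 = 0) ∧
      ((k 22 + k 23) * x 16 - k 21 * (x 4 * x 6) = 0) ∧
      ((k 25 + k 26) * x 20 - k 24 * (x 7 * x 10) = 0) ∧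
      (k 23 * x 16 - k 26 * x 20 = 0) ∧
      ((k 31 + k 32) * x 22 - k 30 * (x 1 * x 7) = 0) ∧
      ((k 34 + k 35) * x 23 - k 33 * (x 11 * x 24) = 0) ∧
      (k 32 * x 22 - k 35 * x 23 = 0)) := by
  constructor
  · intro h
    have H : ∀ j, massAction3 k x j = 0 := fun j => congrFun h j
    simp only [massAction_eq] at H
    have h0 := H 0
    have h2 := H 2
    have h5 := H 5
    have h7 := H 7
    have h4 := H 4
    have h24 := H 24
    have h12 := H 12
    have h13 := H 13
    have h14 := H 14
    have h15 := H 15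
    have h16 := H 16
    have h17 := H 17
    have h18 := H 18
    have h19 := H 19
    have h20 := H 20
    have h21 := H 21
    have h22 := H 22
    have h23 := H 23
    clear H h hk
    simp [mot, ee] at h0 h2 h5 h7 h4 h24 h12 h13 h14 h15 h16 h17 h18 h19 h20 h21 h22 h23
    refine ⟨?_, ?_, ?_, ?_, ?_, ?_, ?_, ?_, ?_, ?_, ?_, ?_, ?_, ?_, ?_, ?_, ?_, ?_⟩ <;> linarith
  · rintro ⟨h1, h2, h3, h4, h5, h6, h7, h8, h9, h10, h11, h12, h13, h14, h15, h16, h17, h18⟩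
    funext j
    rw [massAction_eq]
    clear hk
    fin_cases j <;> simp [mot, ee] <;> linarith
end

section
/- The ℝ-linear span in ℝ^25 of the 36 reaction vectors y_i' − y_i of Net3 (which coincide with the reaction vectors of its translation Tran3) has dimension exactly 18; since the translated network Tran3 has 24 complexes and 6 linkage classes, its deficiency equals 24 − 6 − 18 = 0. -/
/-- The reaction vector `yᵢ' − yᵢ ∈ ℝ^25` of the `i`-th reaction of Net3
(these coincide with the reaction vectors of the translation Tran3). -/
def reactionVec3 (i : Fin 36) : Fin 25 → ℝ :=
  fun j => (tgt3 i j : ℝ) - (src3 i j : ℝ)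

def RZ : Matrix (Fin 36) (Fin 25) ℤ := fun i j => (tgt3 i j : ℤ) - (src3 i j : ℤ)

def selR : Fin 18 → Fin 36 := ![0, 3, 6, 9, 12, 15, 18, 21, 24, 27, 30, 33, 2, 8, 11, 20, 23, 32]

/-- columns of a right inverse of the selected rows, listed as rows -/
def LZ : Fin 18 → Fin 25 → ℤ := ![![-1, 0, 0, 0, 0, 0, 0, 0, 0, 0, 0, 0, 0, 0, 0, 0, 0, 0, 0, 0, 0, 0, 0, 0, 0],
  ![0, 0, 0, 0, 0, 0, 0, 0, 0, 0, 0, 0, 0, 0, 0, 0, 0, 1, 0, 0, 0, 0, 0, 0, 0],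
  ![0, 0, -1, 0, 0, 0, 0, 0, 0, 0, 0, 0, 0, 0, 0, 0, 0, 0, 0, 0, 0, 0, 0, 0, 0],
  ![0, 0, 0, 0, 1, 0, 0, 0, 0, 0, 0, 0, 0, 0, 1, 1, 1, 0, 1, 0, 0, 0, 0, 0, 0],
  ![0, 0, 0, 0, 0, 0, 0, 0, 0, 0, 0, 0, 0, 0, 0, 0, 0, 0, 1, 0, 0, 0, 0, 0, 0],
  ![0, 0, 0, 0, 0, 0, 0, 0, 0, 0, 0, 0, 0, 0, 0, 0, 0, 0, 0, 1, 0, 0, 0, 0, 0],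
  ![0, 0, 0, 0, 0, -1, 0, 0, 0, 0, 0, 0, 0, 0, 0, 0, 0, 0, 0, 0, 0, 0, 0, 0, 0],
  ![0, 0, 0, 0, 0, 0, 0, 1, 0, 0, 0, 0, 0, 0, 0, 0, 1, 0, 0, 0, 1, 0, 1, 0, 0],
  ![0, 0, 0, 0, 0, 0, 0, 0, 0, 0, 0, 0, 0, 0, 0, 0, 0, 0, 0, 0, 1, 0, 0, 0, 0],
  ![0, 0, 0, 0, 0, 0, 0, 0, 0, 0, 0, 0, 0, 0, 0, 0, 0, 0, 0, 0, 0, 1, 0, 0, 0],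
  ![0, 0, 0, 0, 0, 0, 0, 0, 0, 0, 0, 0, 0, 0, 0, 0, 0, 0, 0, 0, 0, 0, 1, 1, 1],
  ![0, 0, 0, 0, 0, 0, 0, 0, 0, 0, 0, 0, 0, 0, 0, 0, 0, 0, 0, 0, 0, 0, 0, 1, 0],
  ![-1, 0, 0, 0, 0, 0, 0, 0, 0, 0, 0, 0, -1, 0, 0, 0, 0, 0, 0, 0, 0, 0, 0, 0, 0],
  ![0, 0, -1, 0, 0, 0, 0, 0, 0, 0, 0, 0, 0, -1, 0, 0, 0, 0, 0, 0, 0, 0, 0, 0, 0],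
  ![0, 0, 0, 0, 1, 0, 0, 0, 0, 0, 0, 0, 0, 0, 0, 1, 1, 0, 1, 0, 0, 0, 0, 0, 0],
  ![0, 0, 0, 0, 0, -1, 0, 0, 0, 0, 0, 0, 0, 0, 0, -1, 0, 0, 0, 0, 0, 0, 0, 0, 0],
  ![0, 0, 0, 0, 0, 0, 0, 1, 0, 0, 0, 0, 0, 0, 0, 0, 0, 0, 0, 0, 1, 0, 1, 0, 0],
  ![0, 0, 0, 0, 0, 0, 0, 0, 0, 0, 0, 0, 0, 0, 0, 0, 0, 0, 0, 0, 0, 0, 0, 1, 1]]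

/-- conservation laws -/
def KZ : Fin 7 → Fin 25 → ℤ := ![![0, 0, 0, 0, 0, 0, 0, 0, 1, 0, 0, 0, 1, 0, 0, 0, 0, 0, 0, 0, 0, 0, 0, 0, 0],
  ![0, 0, 0, 0, 0, 0, 0, 0, 0, 1, 0, 0, 0, 0, 0, 0, 0, 1, 0, 0, 0, 0, 0, 0, 0],
  ![0, 0, 0, 0, 0, 0, 0, 0, 0, 0, 0, 1, 0, 0, 0, 0, 0, 0, 0, 0, 0, 0, 0, 1, 0],
  ![0, 0, 0, 0, 0, 0, 0, 0, 0, 0, 1, 0, 0, 0, 0, 0, 0, 0, 1, 1, 1, 1, 0, 0, 0],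
  ![1, 1, 0, 0, 0, 0, 0, 0, 0, 0, 0, 0, 1, 1, 1, 0, 0, 1, 0, 0, 0, 0, 1, 1, 1],
  ![0, 0, 1, 1, 1, 0, 0, 0, 0, 0, 0, 0, 0, 1, 1, 1, 1, 0, 1, 1, 0, 0, 0, 0, 0],
  ![0, 0, 0, 0, 0, 1, 1, 1, 0, 0, 0, 0, 0, 0, 0, 1, 1, 0, 0, 0, 1, 1, 1, 0, 0]]

def selK : Fin 7 → Fin 25 := ![8, 9, 11, 10, 0, 2, 5]

set_option maxRecDepth 100000 in
theorem RL_one : ∀ p q : Fin 18, ∑ j, RZ (selR p) j * LZ q j = if p = q then 1 else 0 := by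
  decide +kernel

set_option maxRecDepth 100000 in
theorem RK_zero : ∀ (i : Fin 36) (q : Fin 7), ∑ j, RZ i j * KZ q j = 0 := by
  decide +kernel

theorem K_one : ∀ p q : Fin 7, KZ p (selK q) = if p = q then 1 else 0 := by
  decide +kernel

def RR : Matrix (Fin 36) (Fin 25) ℝ := Matrix.of reactionVec3

theorem RR_eq (i : Fin 36) (j : Fin 25) : RR i j = (RZ i j : ℝ) := by
  simp [RR, RZ, reactionVec3]

theorem rank_lower : 18 ≤ RR.rank := by
  let P : Matrix (Fin 18) (Fin 36) ℝ := fun p i => if i = selR p then 1 else 0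
  let L : Matrix (Fin 25) (Fin 18) ℝ := fun j q => (LZ q j : ℝ)
  have h : P * (RR * L) = 1 := by
    ext p q
    have := RL_one p q
    have h2 : ((∑ j, RZ (selR p) j * LZ q j : ℤ) : ℝ) = ((if p = q then 1 else 0 : ℤ) : ℝ) := by
      rw [this]
    simp only [Matrix.mul_apply]
    simp only [P, L, RR_eq, Matrix.one_apply, ite_mul, one_mul, zero_mul,
      Finset.sum_ite_eq', Finset.sum_ite_eq, Finset.mem_univ, if_true]
    push_cast at h2
    exact h2
  have h1 : (P * (RR * L)).rank = 18 := by
    rw [h, Matrix.rank_one]; simp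
  have h2 := Matrix.rank_mul_le_right P (RR * L)
  have h3 := Matrix.rank_mul_le_left RR L
  omega

theorem rank_upper : RR.rank ≤ 18 := by
  let K : Matrix (Fin 25) (Fin 7) ℝ := fun j q => (KZ q j : ℝ)
  let M : Matrix (Fin 7) (Fin 25) ℝ := fun p j => if j = selK p then 1 else 0
  have h : M * K = 1 := by
    ext p q
    have := K_one q p
    simp only [Matrix.mul_apply]
    simp only [M, K, Matrix.one_apply, ite_mul, one_mul, zero_mul,
      Finset.sum_ite_eq', Finset.sum_ite_eq, Finset.mem_univ, if_true, this]
    simp [eq_comm]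
  have h0 : RR * K = 0 := by
    ext i q
    have h2 : ((∑ j, RZ i j * KZ q j : ℤ) : ℝ) = ((0 : ℤ) : ℝ) := by rw [RK_zero i q]
    simp only [Matrix.mul_apply]
    simp only [K, RR_eq, Matrix.zero_apply]
    push_cast at h2
    exact h2
  have h1 : (M * K).rank = 7 := by
    rw [h, Matrix.rank_one]; simp
  have h2 := Matrix.rank_mul_le_right M K
  have h3 := Matrix.rank_add_rank_le_card_of_mul_eq_zero h0
  simp at h3
  omega

theorem finrank_eq : Module.finrank ℝ (Submodule.span ℝ (Set.range reactionVec3)) = 18 := by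
  have h := Matrix.rank_eq_finrank_span_row RR
  have h1 := rank_lower
  have h2 := rank_upper
  have h3 : RR.row = reactionVec3 := rfl
  rw [h3] at h
  omega

/-- The ℝ-linear span of the 36 reaction vectors of Net3 (equivalently, of its
translation Tran3) has dimension exactly 18; since Tran3 has 24 complexes and 6
linkage classes, its deficiency is `24 - 6 - 18 = 0`. -/
theorem net3_stoichiometric_dimension_and_deficiency :
    Module.finrank ℝ (Submodule.span ℝ (Set.range reactionVec3)) = 18 ∧
    24 - 6 - Module.finrank ℝ (Submodule.span ℝ (Set.range reactionVec3)) = 0 := by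
  exact ⟨finrank_eq, by rw [finrank_eq]⟩
end

section
/- Let v1,…,v24 ∈ ℕ^25 ⊂ ℝ^25 be the kinetic complexes of the translation Tran3 of Net3, grouped into six quadruples (per linkage class): (e1+e9, e13, e2+e10, e18), (e2+e3, e14, e4+e11, e20), (e2+e4, e15, e5+e11, e19), (e5+e6, e16, e7+e11, e22), (e5+e7, e17, e8+e11, e21), (e2+e8, e23, e12+e25, e24), where e_j is the j-th standard basis vector. Within each quadruple (w1,w2,w3,w4) the edges of the translated reaction graph are w1→w2, w2→w1, w2→w3, w3→w4, w4→w3, w4→w1. Then the ℝ-linear span of all edge differences (target minus source, over all 36 edges) has dimension exactly 18; hence the kinetic-order deficiency of Tran3 is 24 − 6 − 18 = 0. -/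
/-- The `j`-th standard basis vector of `ℝ^25`. -/
def eR (j : Fin 25) : Fin 25 → ℝ := fun i => if i = j then 1 else 0

/-- The 24 kinetic complexes of the translation Tran3 of Net3 (as vectors in
`ℕ^25 ⊂ ℝ^25`), grouped into 6 quadruples, one per linkage class. `eR j` is the
standard basis vector of 0-based index `j`, i.e. the species `X(j+1)`. -/
def kinComplex3 : Fin 24 → Fin 25 → ℝ :=
  ![eR 0 + eR 8,
    eR 12,
    eR 1 + eR 9,
    eR 17,
    eR 1 + eR 2,
    eR 13,
    eR 3 + eR 10,
    eR 19,
    eR 1 + eR 3,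
    eR 14,
    eR 4 + eR 10,
    eR 18,
    eR 4 + eR 5,
    eR 15,
    eR 6 + eR 10,
    eR 21,
    eR 4 + eR 6,
    eR 16,
    eR 7 + eR 10,
    eR 20,
    eR 1 + eR 7,
    eR 22,
    eR 11 + eR 24,
    eR 23]

/-- The directed edges of the translated reaction graph of Tran3: within each quadruple
`(w₁, w₂, w₃, w₄)` the edges are `w₁→w₂, w₂→w₁, w₂→w₃, w₃→w₄, w₄→w₃, w₄→w₁`
(pairs are `(source, target)`). -/
def kinEdges3 : Fin 36 → Fin 24 × Fin 24 :=
  ![(0, 1), (1, 0), (1, 2), (2, 3), (3, 2), (3, 0), (4, 5), (5, 4), (5, 6), (6, 7), (7, 6), (7, 4), (8, 9), (9, 8), (9, 10), (10, 11), (11, 10), (11, 8), (12, 13), (13, 12), (13, 14), (14, 15), (15, 14), (15, 12), (16, 17), (17, 16), (17, 18), (18, 19), (19, 18), (19, 16), (20, 21), (21, 20), (21, 22), (22, 23), (23, 22), (23, 20)]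

/-- Difference of kinetic complexes along an edge: target minus source. -/
def kinEdgeDiff3 (i : Fin 36) : Fin 25 → ℝ :=
  kinComplex3 (kinEdges3 i).2 - kinComplex3 (kinEdges3 i).1

def idx3 : Fin 18 → Fin 36 :=
  ![0, 2, 3, 6, 8, 9, 12, 14, 15, 18, 20, 21, 24, 26, 27, 30, 32, 33]

lemma li3 : LinearIndependent ℝ (fun j => kinEdgeDiff3 (idx3 j)) := by
  rw [Fintype.linearIndependent_iff]
  intro g hg
  have h : ∀ x : Fin 25, ∑ j, g j * kinEdgeDiff3 (idx3 j) x = 0 := by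
    intro x
    have := congrFun hg x
    simpa [Finset.sum_apply] using this
  have hx := fun x => h x
  simp only [Fin.sum_univ_succ, Fin.sum_univ_zero, idx3, kinEdgeDiff3, kinEdges3, kinComplex3] at hx
  have h0 := hx 0
  have h1 := hx 1
  have h2 := hx 2
  have h3 := hx 3
  have h4 := hx 4
  have h5 := hx 5
  have h6 := hx 6
  have h7 := hx 7
  have h8 := hx 8
  have h9 := hx 9
  have h10 := hx 10
  have h11 := hx 11
  have h12 := hx 12
  have h13 := hx 13
  have h14 := hx 14
  have h15 := hx 15
  have h16 := hx 16
  have h17 := hx 17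
  have h18 := hx 18
  have h19 := hx 19
  have h20 := hx 20
  have h21 := hx 21
  have h22 := hx 22
  have h23 := hx 23
  have h24 := hx 24
  clear hx h hg
  simp [eR] at h0 h1 h2 h3 h4 h5 h6 h7 h8 h9 h10 h11 h12 h13 h14 h15 h16 h17 h18 h19 h20 h21 h22 h23 h24
  intro i
  fin_cases i <;> simp <;> linarith

lemma span3 : Submodule.span ℝ (Set.range kinEdgeDiff3) =
    Submodule.span ℝ (Set.range (fun j => kinEdgeDiff3 (idx3 j))) := by
  apply le_antisymm
  · rw [Submodule.span_le]
    have h : ∀ j, kinEdgeDiff3 (idx3 j) ∈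
        Submodule.span ℝ (Set.range (fun j => kinEdgeDiff3 (idx3 j))) :=
      fun j => Submodule.subset_span ⟨j, rfl⟩
    generalize Submodule.span ℝ (Set.range (fun j => kinEdgeDiff3 (idx3 j))) = S at h
    have n : ∀ a b : Fin 24, kinComplex3 b - kinComplex3 a ∈ S →
        kinComplex3 a - kinComplex3 b ∈ S := by
      intro a b hab
      rw [← neg_sub]
      exact S.neg_mem hab
    have t : ∀ a b c d : Fin 24, kinComplex3 b - kinComplex3 a ∈ S →
        kinComplex3 c - kinComplex3 b ∈ S → kinComplex3 d - kinComplex3 c ∈ S →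
        kinComplex3 a - kinComplex3 d ∈ S := by
      intro a b c d h1 h2 h3
      apply n
      have := S.add_mem (S.add_mem h1 h2) h3
      convert this using 1
      abel
    rintro _ ⟨i, rfl⟩
    fin_cases i
    · exact h 0
    · exact n 0 1 (h 0)
    · exact h 1
    · exact h 2
    · exact n 2 3 (h 2)
    · exact t 0 1 2 3 (h 0) (h 1) (h 2)
    · exact h 3
    · exact n 4 5 (h 3)
    · exact h 4
    · exact h 5
    · exact n 6 7 (h 5)
    · exact t 4 5 6 7 (h 3) (h 4) (h 5)
    · exact h 6
    · exact n 8 9 (h 6)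
    · exact h 7
    · exact h 8
    · exact n 10 11 (h 8)
    · exact t 8 9 10 11 (h 6) (h 7) (h 8)
    · exact h 9
    · exact n 12 13 (h 9)
    · exact h 10
    · exact h 11
    · exact n 14 15 (h 11)
    · exact t 12 13 14 15 (h 9) (h 10) (h 11)
    · exact h 12
    · exact n 16 17 (h 12)
    · exact h 13
    · exact h 14
    · exact n 18 19 (h 14)
    · exact t 16 17 18 19 (h 12) (h 13) (h 14)
    · exact h 15
    · exact n 20 21 (h 15)
    · exact h 16
    · exact h 17
    · exact n 22 23 (h 17)
    · exact t 20 21 22 23 (h 15) (h 16) (h 17)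
  · apply Submodule.span_mono
    rintro _ ⟨j, rfl⟩
    exact ⟨idx3 j, rfl⟩

/-- The ℝ-linear span of the edge differences of kinetic complexes over all 36 edges of
Tran3 has dimension exactly 18; hence the kinetic-order deficiency of Tran3 is
`24 - 6 - 18 = 0`. -/
theorem tran3_kinetic_order_dimension_and_deficiency :
    Module.finrank ℝ (Submodule.span ℝ (Set.range kinEdgeDiff3)) = 18 ∧
    24 - 6 - Module.finrank ℝ (Submodule.span ℝ (Set.range kinEdgeDiff3)) = 0 := by
  have h : Module.finrank ℝ (Submodule.span ℝ (Set.range kinEdgeDiff3)) = 18 := by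
    rw [span3, finrank_span_eq_card li3]
    simp
  exact ⟨h, by rw [h]⟩
end
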